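/- arXiv:1903.03697 — 7 statements merged into one kernel-verified Lean document; each statement's English description precedes it below -/
import Mathlib

section
/- Let ℓ ≥ 1 be a natural number, κ : Fin ℓ → ℝ with κ_j > 0 for every j, R = Σ_j κ_j, and L > 0. Then for every z in the rebalancing simplex S, F̄(z) ≥ F̄(κ), with equality if and only if z = κ. In particular κ is the unique minimizer of the dummy-edge cost F̄ over S. -/
/-- The excess of the BPR cost `z * (L * (1 + 0.15 * (z / k) ^ 4))` over its tangent line
at `z = k`. -/
theorem bpr_cost_sub_tangent {k : ℝ} (hk : k ≠ 0) (L z : ℝ) :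
    z * (L * (1 + 0.15 * (z / k) ^ 4)) - k * (L * (1 + 0.15 * (k / k) ^ 4))
        - 1.75 * L * (z - k) =
      0.15 * L * k * ((z / k - 1) ^ 2 *
        ((z / k) ^ 3 + 2 * (z / k) ^ 2 + 3 * (z / k) + 4)) := by
  field_simp
  ring

/-- Lemma 1: On the rebalancing simplex
`S = {z | z_j ≥ 0 ∧ Σ_j z_j = R}` with `R = Σ_j κ_j`, the dummy-edge cost
`F̄(z) = Σ_j z_j · L·(1 + 0.15·(z_j/κ_j)^4)` satisfies `F̄(z) ≥ F̄(κ)`,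
with equality iff `z = κ`; in particular `κ` is its unique minimizer. -/
theorem dummy_cost_unique_minimizer
    (ℓ : ℕ) (hℓ : 1 ≤ ℓ) (κ : Fin ℓ → ℝ) (hκ : ∀ j, 0 < κ j)
    (L : ℝ) (hL : 0 < L) (R : ℝ) (hR : R = ∑ j, κ j)
    (Fbar : (Fin ℓ → ℝ) → ℝ)
    (hFbar : ∀ z : Fin ℓ → ℝ,
      Fbar z = ∑ j, z j * (L * (1 + 0.15 * (z j / κ j) ^ 4))) :
    ∀ z : Fin ℓ → ℝ, (∀ j, 0 ≤ z j) → (∑ j, z j) = R →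
      Fbar κ ≤ Fbar z ∧ (Fbar z = Fbar κ ↔ z = κ) := by
  intro z hz hsum
  have hdiff : Fbar z - Fbar κ = ∑ j, 0.15 * L * κ j * ((z j / κ j - 1) ^ 2 *
      ((z j / κ j) ^ 3 + 2 * (z j / κ j) ^ 2 + 3 * (z j / κ j) + 4)) := by
    have htangent : ∑ j, 1.75 * L * (z j - κ j) = 0 := by
      rw [← Finset.mul_sum, Finset.sum_sub_distrib, hsum, hR, sub_self, mul_zero]
    rw [← Finset.sum_congr rfl fun j _ => bpr_cost_sub_tangent (hκ j).ne' L (z j),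
      Finset.sum_sub_distrib, htangent, Finset.sum_sub_distrib, hFbar, hFbar, sub_zero]
  have hpos : ∀ j, 0 < (z j / κ j) ^ 3 + 2 * (z j / κ j) ^ 2 + 3 * (z j / κ j) + 4 := by
    intro j
    have := div_nonneg (hz j) (hκ j).le
    positivity
  have hnonneg : ∀ j ∈ Finset.univ, 0 ≤ 0.15 * L * κ j * ((z j / κ j - 1) ^ 2 *
      ((z j / κ j) ^ 3 + 2 * (z j / κ j) ^ 2 + 3 * (z j / κ j) + 4)) := by
    intro j _
    have := hκ j
    have := hpos j
    positivity
  refine ⟨sub_nonneg.mp (hdiff ▸ Finset.sum_nonneg hnonneg), fun h => ?_, fun h => by rw [h]⟩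
  rw [h, sub_self, eq_comm, Finset.sum_eq_zero_iff_of_nonneg hnonneg] at hdiff
  funext j
  have hc : 0.15 * L * κ j ≠ 0 := by
    have := hκ j
    positivity
  have hsq := (mul_eq_zero.mp ((mul_eq_zero.mp (hdiff j (Finset.mem_univ j))).resolve_left
    hc)).resolve_right (hpos j).ne'
  exact (div_eq_one_iff_eq (hκ j).ne').mp (sub_eq_zero.mp (pow_eq_zero_iff two_ne_zero |>.mp hsq))
end

section
/- Let L > 0 and κ > 0 be real numbers. Then for every x ≥ 0, writing Δ = x − κ, the edge system cost satisfies x · L·(1 + 0.15·(x/κ)^4) ≥ L·(1.15·κ + 1.75·Δ + 0.6·Δ²/κ). -/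
/-- per-edge quadratic lower bound: for `L, κ > 0` and `x ≥ 0`,
writing `Δ = x − κ`, the edge system cost satisfies
`x · L·(1 + 0.15·(x/κ)^4) ≥ L·(1.15·κ + 1.75·Δ + 0.6·Δ²/κ)`. -/
theorem dummy_edge_system_cost_quadratic_bound
    (L κ : ℝ) (hL : 0 < L) (hκ : 0 < κ) :
    ∀ x : ℝ, 0 ≤ x →
      x * (L * (1 + 0.15 * (x / κ) ^ 4))
        ≥ L * (1.15 * κ + 1.75 * (x - κ) + 0.6 * (x - κ) ^ 2 / κ) := by
  intro x hx
  obtain ⟨t, rfl⟩ : ∃ t, x = t * κ := ⟨x / κ, by field_simp⟩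
  have ht : 0 ≤ t := nonneg_of_mul_nonneg_left hx hκ
  have key : t * κ * (L * (1 + 0.15 * (t * κ / κ) ^ 4))
      - L * (1.15 * κ + 1.75 * (t * κ - κ) + 0.6 * (t * κ - κ) ^ 2 / κ)
      = 0.15 * L * κ * t * (t - 1) ^ 2 * ((t + 1) ^ 2 + 2) := by
    field_simp
    ring
  have : 0 ≤ 0.15 * L * κ * t * (t - 1) ^ 2 * ((t + 1) ^ 2 + 2) := by positivity
  linarith
end

section
/- Let ℓ ≥ 1 be a natural number, κ : Fin ℓ → ℝ with κ_j > 0 for every j, R = Σ_j κ_j, and L > 0. Then for every z in the rebalancing simplex S, F̄(z) ≥ F̄(κ) + (0.6·L/(R·ℓ))·(Σ_j |z_j − κ_j|)², where F̄(κ) = 1.15·L·R. -/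
/-- A Bernoulli-type bound with a quadratic remainder. -/
lemma pow_five_ge_quadratic {t : ℝ} (ht : 0 ≤ t) :
    1 + 5 * (t - 1) + 4 * (t - 1) ^ 2 ≤ t ^ 5 := by
  have h : 0 ≤ (t - 1) ^ 2 * (t ^ 3 + 2 * t ^ 2 + 3 * t) := by positivity
  linarith

/-- The quadratic lower bound for the cost of a single edge. -/
lemma edge_cost_ge_quadratic {k z L : ℝ} (hk : 0 < k) (hz : 0 ≤ z) (hL : 0 < L) :
    1.15 * L * k + 1.75 * L * (z - k) + 0.6 * L * (|z - k| ^ 2 / k) ≤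
      z * (L * (1 + 0.15 * (z / k) ^ 4)) := by
  obtain ⟨t, rfl⟩ : ∃ t, z = t * k := ⟨z / k, by field_simp⟩
  have ht : 0 ≤ t := nonneg_of_mul_nonneg_left hz hk
  have hq : |t * k - k| ^ 2 / k = k * (t - 1) ^ 2 := by
    rw [sq_abs]
    field_simp
  rw [hq, mul_div_cancel_right₀ _ hk.ne']
  have h := mul_le_mul_of_nonneg_left (pow_five_ge_quadratic ht) (mul_pos hL hk).le
  linarith

/-- quadratic growth of the dummy cost: on the rebalancing
simplex, `F̄(z) ≥ F̄(κ) + (0.6·L/(R·ℓ))·(Σ_j |z_j − κ_j|)²`, where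
`F̄(κ) = 1.15·L·R`. -/
theorem dummy_cost_quadratic_growth
    (ℓ : ℕ) (hℓ : 1 ≤ ℓ) (κ : Fin ℓ → ℝ) (hκ : ∀ j, 0 < κ j)
    (L : ℝ) (hL : 0 < L) (R : ℝ) (hR : R = ∑ j, κ j)
    (Fbar : (Fin ℓ → ℝ) → ℝ)
    (hFbar : ∀ z : Fin ℓ → ℝ,
      Fbar z = ∑ j, z j * (L * (1 + 0.15 * (z j / κ j) ^ 4))) :
    Fbar κ = 1.15 * L * R ∧
    ∀ z : Fin ℓ → ℝ, (∀ j, 0 ≤ z j) → (∑ j, z j) = R →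
      Fbar z ≥ Fbar κ + (0.6 * L / (R * (ℓ : ℝ))) * (∑ j, |z j - κ j|) ^ 2 := by
  subst hR
  have hFκ : Fbar κ = 1.15 * L * ∑ j, κ j := by
    rw [hFbar, Finset.mul_sum]
    refine Finset.sum_congr rfl fun j _ => ?_
    rw [div_self (hκ j).ne']
    ring
  refine ⟨hFκ, fun z hz hsum => ?_⟩
  have hℓ' : (1 : ℝ) ≤ ℓ := by exact_mod_cast hℓ
  have hR : 0 < ∑ j, κ j :=
    Finset.sum_pos (fun j _ => hκ j) ⟨⟨0, hℓ⟩, Finset.mem_univ _⟩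
  have hcs : (∑ j, |z j - κ j|) ^ 2 / ∑ j, κ j ≤ ∑ j, |z j - κ j| ^ 2 / κ j :=
    Finset.sq_sum_div_le_sum_sq_div _ _ fun j _ => hκ j
  have hedge := Finset.sum_le_sum fun j (_ : j ∈ Finset.univ) =>
    edge_cost_ge_quadratic (hκ j) (hz j) hL
  rw [Finset.sum_add_distrib, Finset.sum_add_distrib, ← Finset.mul_sum, ← Finset.mul_sum,
    ← Finset.mul_sum, Finset.sum_sub_distrib, hsum, sub_self, mul_zero, add_zero,
    ← hFbar, ← hFκ] at hedge
  refine le_trans ?_ hedge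
  refine add_le_add_right ?_ _
  calc 0.6 * L / ((∑ j, κ j) * ℓ) * (∑ j, |z j - κ j|) ^ 2
      ≤ 0.6 * L / (∑ j, κ j) * (∑ j, |z j - κ j|) ^ 2 := by
        gcongr
        exact le_mul_of_one_le_right hR.le hℓ'
    _ = 0.6 * L * ((∑ j, |z j - κ j|) ^ 2 / ∑ j, κ j) := by ring
    _ ≤ 0.6 * L * ∑ j, |z j - κ j| ^ 2 / κ j := by gcongr
end

section
/- Let ℓ ≥ 1 be a natural number, κ : Fin ℓ → ℝ with κ_j > 0 for every j, R = Σ_j κ_j, L > 0, and δ ∈ (0, 1]. Then for every z in the rebalancing simplex S with Σ_j |z_j − κ_j| ≥ 2·R·δ, one has F̄(z) − F̄(κ) ≥ 2.4·R·L·δ²/ℓ. -/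
/-- A quadratic strengthening of the tangent line bound for `u ↦ u ^ 5` at `1` on `[0, ∞)`. -/
lemma pow_five_ge_tangent_add_sq {u : ℝ} (hu : 0 ≤ u) :
    1 + 5 * (u - 1) + 4 * (u - 1) ^ 2 ≤ u ^ 5 := by
  have h : 0 ≤ (u - 1) ^ 2 * (u * (u ^ 2 + 2 * u + 3)) := by positivity
  linarith [show u ^ 5 - (1 + 5 * (u - 1) + 4 * (u - 1) ^ 2) =
    (u - 1) ^ 2 * (u * (u ^ 2 + 2 * u + 3)) by ring]

/-- Quadratic growth of a single edge cost around its capacity `k`. -/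
lemma edge_cost_ge_tangent_add_sq {k z L : ℝ} (hk : 0 < k) (hz : 0 ≤ z) (hL : 0 ≤ L) :
    k * (L * (1 + 0.15 * (k / k) ^ 4)) + 1.75 * L * (z - k) + 0.6 * L * (|z - k| ^ 2 / k) ≤
      z * (L * (1 + 0.15 * (z / k) ^ 4)) := by
  obtain ⟨u, rfl⟩ : ∃ u, z = k * u := ⟨z / k, by field_simp⟩
  have hu : 0 ≤ u := nonneg_of_mul_nonneg_right hz hk
  have h := mul_le_mul_of_nonneg_left (pow_five_ge_tangent_add_sq hu) (mul_nonneg hk.le hL)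
  have hsq : |k * u - k| ^ 2 / k = k * (u - 1) ^ 2 := by
    rw [sq_abs]
    field_simp
  rw [hsq, div_self hk.ne', mul_div_cancel_left₀ u hk.ne']
  linarith


/-- concluding estimate of Theorem 1: any flow on the
rebalancing simplex whose ℓ¹ distance from `κ` is at least `2·R·δ` pays an
extra dummy cost of at least `2.4·R·L·δ²/ℓ`. -/
theorem dummy_cost_gap_of_unfulfilled_fraction
    (ℓ : ℕ) (hℓ : 1 ≤ ℓ) (κ : Fin ℓ → ℝ) (hκ : ∀ j, 0 < κ j)
    (L : ℝ) (hL : 0 < L) (R : ℝ) (hR : R = ∑ j, κ j)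
    (δ : ℝ) (hδ : δ ∈ Set.Ioc (0 : ℝ) 1)
    (Fbar : (Fin ℓ → ℝ) → ℝ)
    (hFbar : ∀ z : Fin ℓ → ℝ,
      Fbar z = ∑ j, z j * (L * (1 + 0.15 * (z j / κ j) ^ 4))) :
    ∀ z : Fin ℓ → ℝ, (∀ j, 0 ≤ z j) → (∑ j, z j) = R →
      (∑ j, |z j - κ j|) ≥ 2 * R * δ →
      Fbar z - Fbar κ ≥ 2.4 * R * L * δ ^ 2 / (ℓ : ℝ) := by
  intro z hz hzR hdev
  have hRpos : 0 < R := hR ▸ Finset.sum_pos (fun j _ => hκ j) ⟨⟨0, hℓ⟩, Finset.mem_univ _⟩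
  have hδ0 : 0 < δ := hδ.1
  have hℓ' : (1 : ℝ) ≤ ℓ := by exact_mod_cast hℓ
  have hgap : 0.6 * L * ∑ j, |z j - κ j| ^ 2 / κ j ≤ Fbar z - Fbar κ := by
    have h := Finset.sum_le_sum fun j (_ : j ∈ Finset.univ) =>
      edge_cost_ge_tangent_add_sq (hκ j) (hz j) hL.le
    rw [Finset.sum_add_distrib, Finset.sum_add_distrib, ← Finset.mul_sum, ← Finset.mul_sum,
      Finset.sum_sub_distrib, hzR, ← hR, sub_self, ← hFbar, ← hFbar] at h
    linarith
  have hcauchy : (2 * R * δ) ^ 2 / R ≤ ∑ j, |z j - κ j| ^ 2 / κ j :=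
    calc (2 * R * δ) ^ 2 / R ≤ (∑ j, |z j - κ j|) ^ 2 / R := by gcongr
      _ ≤ ∑ j, |z j - κ j| ^ 2 / κ j := by
        rw [hR]
        exact Finset.sq_sum_div_le_sum_sq_div _ _ fun j _ => hκ j
  calc 2.4 * R * L * δ ^ 2 / (ℓ : ℝ) ≤ 2.4 * R * L * δ ^ 2 := div_le_self (by positivity) hℓ'
    _ = 0.6 * L * ((2 * R * δ) ^ 2 / R) := by
      field_simp
      norm_num
    _ ≤ 0.6 * L * ∑ j, |z j - κ j| ^ 2 / κ j := by gcongr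
    _ ≤ Fbar z - Fbar κ := hgap
end

section
/- Let ℓ ≥ 1, κ : Fin ℓ → ℝ with κ_j > 0, R = Σ_j κ_j, δ ∈ (0, 1], and let A, φ, κ', F, F̄, S, C be as in the AMoD-to-TAP setting. Suppose (u⁰, κ) ∈ C and L > F(u⁰)·ℓ/(2.4·R·δ²). Then every (u, z) ∈ C with Σ_j |z_j − κ_j| > 2·R·δ satisfies F(u) + F̄(z) > F(u⁰) + F̄(κ). -/
/-- Pointwise form of the strong convexity of `x ↦ x ^ 5` on `[0, ∞)` at `1`, in homogeneous
coordinates. -/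
lemma mul_div_pow_four_ge {z k : ℝ} (hz : 0 ≤ z) (hk : 0 < k) :
    k + 5 * (z - k) + 4 * (|z - k| ^ 2 / k) ≤ z * (z / k) ^ 4 := by
  obtain ⟨x, rfl⟩ : ∃ x, z = k * x := ⟨z / k, by field_simp⟩
  have hx : 0 ≤ x := nonneg_of_mul_nonneg_right hz hk
  have h : 0 ≤ k * ((x - 1) ^ 2 * (x ^ 3 + 2 * x ^ 2 + 3 * x)) := by positivity
  have h₁ : k * x / k = x := by field_simp
  have h₂ : |k * x - k| ^ 2 / k = k * (x - 1) ^ 2 := by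
    rw [sq_abs]
    field_simp
  rw [h₁, h₂]
  linear_combination h

/-- Quadratic growth of the quartic congestion cost away from the capacity vector, in terms of the
`ℓ¹` distance. -/
lemma sum_mul_div_pow_four_ge {ι : Type*} [Fintype ι] {z k : ι → ℝ} (hz : ∀ j, 0 ≤ z j)
    (hk : ∀ j, 0 < k j) (hzk : ∑ j, z j = ∑ j, k j) :
    ∑ j, k j + 4 * ((∑ j, |z j - k j|) ^ 2 / ∑ j, k j) ≤ ∑ j, z j * (z j / k j) ^ 4 := by
  have h := Finset.sum_le_sum fun j (_ : j ∈ Finset.univ) ↦ mul_div_pow_four_ge (hz j) (hk j)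
  have hcs := Finset.sq_sum_div_le_sum_sq_div Finset.univ (fun j ↦ |z j - k j|)
    (fun j _ ↦ hk j)
  simp only [Finset.sum_add_distrib, ← Finset.mul_sum, Finset.sum_sub_distrib] at h
  linarith


/-- explicit-constant version of Theorem 1: in the AMoD-to-TAP
setting, if `(u⁰, κ)` is feasible and `L > F(u⁰)·ℓ/(2.4·R·δ²)`, then every
feasible `(u, z)` with `Σ_j |z_j − κ_j| > 2·R·δ` has strictly larger total
cost than `(u⁰, κ)`. -/
theorem amod_tap_explicit_constant
    (ℓ : ℕ) (hℓ : 1 ≤ ℓ) (κ : Fin ℓ → ℝ) (hκ : ∀ j, 0 < κ j)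
    (R : ℝ) (hR : R = ∑ j, κ j)
    (δ : ℝ) (hδ : δ ∈ Set.Ioc (0 : ℝ) 1)
    (A : Type*) [Fintype A] (φ κ' : A → ℝ)
    (hφ : ∀ a, 0 < φ a) (hκ' : ∀ a, 0 < κ' a)
    (L : ℝ) (hL : 0 < L)
    (F : (A → ℝ) → ℝ)
    (hF : ∀ u : A → ℝ,
      F u = ∑ a, u a * (φ a * (1 + 0.15 * (u a / κ' a) ^ 4)))
    (Fbar : (Fin ℓ → ℝ) → ℝ)
    (hFbar : ∀ z : Fin ℓ → ℝ,
      Fbar z = ∑ j, z j * (L * (1 + 0.15 * (z j / κ j) ^ 4)))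
    (C : Set ((A → ℝ) × (Fin ℓ → ℝ)))
    (hC : ∀ p ∈ C, (∀ a, 0 ≤ p.1 a) ∧ (∀ j, 0 ≤ p.2 j) ∧ (∑ j, p.2 j) = R)
    (u0 : A → ℝ) (hu0 : (u0, κ) ∈ C)
    (hLbig : L > F u0 * (ℓ : ℝ) / (2.4 * R * δ ^ 2)) :
    ∀ p ∈ C, (∑ j, |p.2 j - κ j|) > 2 * R * δ →
      F p.1 + Fbar p.2 > F u0 + Fbar κ := by
  rintro ⟨u, z⟩ hp hdist
  obtain ⟨hu, hz, hzR⟩ := hC _ hp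
  obtain ⟨hδ₀, -⟩ := hδ
  dsimp only at hu hz hzR hdist ⊢
  have hF_nonneg (v : A → ℝ) (hv : ∀ a, 0 ≤ v a) : 0 ≤ F v := by
    rw [hF]
    refine Finset.sum_nonneg fun a _ ↦ mul_nonneg (hv a) (mul_nonneg (hφ a).le ?_)
    positivity
  have hFu := hF_nonneg u hu
  have hFu0 := hF_nonneg u0 (hC _ hu0).1
  have hRpos : 0 < R := by
    rw [hR]
    exact Finset.sum_pos (fun j _ ↦ hκ j) ⟨⟨0, hℓ⟩, Finset.mem_univ _⟩
  have hFbar_eq (w : Fin ℓ → ℝ) :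
      Fbar w = L * (∑ j, w j + 0.15 * ∑ j, w j * (w j / κ j) ^ 4) := by
    rw [hFbar, Finset.mul_sum, ← Finset.sum_add_distrib, Finset.mul_sum]
    exact Finset.sum_congr rfl fun j _ ↦ by ring
  have hκ_sum : ∑ j, κ j * (κ j / κ j) ^ 4 = R := by
    rw [hR]
    exact Finset.sum_congr rfl fun j _ ↦ by rw [div_self (hκ j).ne', one_pow, mul_one]
  have hgrowth := sum_mul_div_pow_four_ge hz hκ (hzR.trans hR)
  rw [← hR] at hgrowth
  have hquad : 4 * R * δ ^ 2 ≤ (∑ j, |z j - κ j|) ^ 2 / R := by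
    rw [le_div_iff₀ hRpos]
    calc 4 * R * δ ^ 2 * R = (2 * R * δ) ^ 2 := by ring
      _ ≤ _ := pow_le_pow_left₀ (by positivity) hdist.le 2
  have hcost : F u0 < L * (2.4 * R * δ ^ 2) :=
    calc F u0 ≤ F u0 * ℓ := le_mul_of_one_le_right hFu0 (by exact_mod_cast hℓ)
      _ < _ := (div_lt_iff₀ (by positivity)).mp hLbig
  have hgap : L * (R + 16 * R * δ ^ 2) ≤ L * ∑ j, z j * (z j / κ j) ^ 4 :=
    mul_le_mul_of_nonneg_left (by linarith) hL.le
  rw [hFbar_eq, hFbar_eq, hκ_sum, hzR, ← hR]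
  linarith
end

section
/- Let ℓ ≥ 1, κ : Fin ℓ → ℝ with κ_j > 0, R = Σ_j κ_j, L > 0, and let A, φ, κ', F, F̄, S, C be as in the AMoD-to-TAP setting. Suppose (u⁰, κ) ∈ C, and suppose (u*, z*) ∈ C satisfies F(u*) + F̄(z*) ≤ F(u) + F̄(z) for all (u, z) ∈ C, with z* ≠ κ. Then F(u*) < F(u⁰). -/
/-- The Bureau of Public Roads cost `x * (L * (1 + 0.15 * (x / k) ^ 4))` lies above its tangent
line at the capacity `k`. -/
theorem bpr_cost_tangent_le {k L x : ℝ} (hk : 0 < k) (hL : 0 < L) (hx : 0 ≤ x) :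
    k * (L * (1 + 0.15 * (k / k) ^ 4)) + 1.75 * L * (x - k) ≤
      x * (L * (1 + 0.15 * (x / k) ^ 4)) := by
  obtain ⟨t, rfl⟩ : ∃ t, x = k * t := ⟨x / k, by field_simp⟩
  have ht : 0 ≤ t := nonneg_of_mul_nonneg_right hx hk
  have h : 0 ≤ 0.15 * k * L * ((t - 1) ^ 2 * (t ^ 3 + 2 * t ^ 2 + 3 * t + 4)) := by positivity
  rw [div_self hk.ne', mul_div_cancel_left₀ _ hk.ne']
  linear_combination h

/-- Away from the capacity the tangent line inequality for the Bureau of Public Roads cost is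
strict. -/
theorem bpr_cost_tangent_lt {k L x : ℝ} (hk : 0 < k) (hL : 0 < L) (hx : 0 ≤ x) (hne : x ≠ k) :
    k * (L * (1 + 0.15 * (k / k) ^ 4)) + 1.75 * L * (x - k) <
      x * (L * (1 + 0.15 * (x / k) ^ 4)) := by
  obtain ⟨t, rfl⟩ : ∃ t, x = k * t := ⟨x / k, by field_simp⟩
  have ht : 0 ≤ t := nonneg_of_mul_nonneg_right hx hk
  have ht1 : t - 1 ≠ 0 := fun h => hne (by rw [sub_eq_zero.mp h, mul_one])
  have h : 0 < 0.15 * k * L * ((t - 1) ^ 2 * (t ^ 3 + 2 * t ^ 2 + 3 * t + 4)) := by positivity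
  rw [div_self hk.ne', mul_div_cancel_left₀ _ hk.ne']
  linear_combination h

/-- The capacity vector `κ` is the unique minimizer of the total Bureau of Public Roads cost among
the nonnegative flows of the same total volume. -/
theorem sum_bpr_cost_lt {ι : Type*} [Fintype ι] {κ z : ι → ℝ} {L : ℝ} (hκ : ∀ j, 0 < κ j)
    (hL : 0 < L) (hz : ∀ j, 0 ≤ z j) (hsum : ∑ j, z j = ∑ j, κ j) (hne : z ≠ κ) :
    ∑ j, κ j * (L * (1 + 0.15 * (κ j / κ j) ^ 4)) <
      ∑ j, z j * (L * (1 + 0.15 * (z j / κ j) ^ 4)) := by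
  obtain ⟨i, hi⟩ := Function.ne_iff.mp hne
  have h := Finset.sum_lt_sum (fun j _ => bpr_cost_tangent_le (hκ j) hL (hz j))
    ⟨i, Finset.mem_univ i, bpr_cost_tangent_lt (hκ i) hL (hz i) hi⟩
  rwa [Finset.sum_add_distrib, ← Finset.mul_sum, Finset.sum_sub_distrib, hsum, sub_self, mul_zero,
    add_zero] at h


/-- Corollary 1, bounded cost of routing: in the AMoD-to-TAP
setting, if `(u⁰, κ)` is feasible and `(u*, z*)` minimizes `F(u) + F̄(z)` over
the feasible set `C` with `z* ≠ κ`, then `F(u*) < F(u⁰)`. -/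
theorem amod_tap_bounded_cost_of_routing
    (ℓ : ℕ) (hℓ : 1 ≤ ℓ) (κ : Fin ℓ → ℝ) (hκ : ∀ j, 0 < κ j)
    (R : ℝ) (hR : R = ∑ j, κ j) (L : ℝ) (hL : 0 < L)
    (A : Type*) [Fintype A] (φ κ' : A → ℝ)
    (hφ : ∀ a, 0 < φ a) (hκ' : ∀ a, 0 < κ' a)
    (F : (A → ℝ) → ℝ)
    (hF : ∀ u : A → ℝ,
      F u = ∑ a, u a * (φ a * (1 + 0.15 * (u a / κ' a) ^ 4)))
    (Fbar : (Fin ℓ → ℝ) → ℝ)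
    (hFbar : ∀ z : Fin ℓ → ℝ,
      Fbar z = ∑ j, z j * (L * (1 + 0.15 * (z j / κ j) ^ 4)))
    (C : Set ((A → ℝ) × (Fin ℓ → ℝ)))
    (hC : ∀ p ∈ C, (∀ a, 0 ≤ p.1 a) ∧ (∀ j, 0 ≤ p.2 j) ∧ (∑ j, p.2 j) = R)
    (u0 : A → ℝ) (hu0 : (u0, κ) ∈ C)
    (ustar : A → ℝ) (zstar : Fin ℓ → ℝ) (hstar : (ustar, zstar) ∈ C)
    (hmin : ∀ p ∈ C, F ustar + Fbar zstar ≤ F p.1 + Fbar p.2)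
    (hne : zstar ≠ κ) :
    F ustar < F u0 := by
  obtain ⟨-, hz, hsum⟩ := hC _ hstar
  have hlt : Fbar κ < Fbar zstar := by
    rw [hFbar, hFbar]
    exact sum_bpr_cost_lt hκ hL hz (hsum.trans hR) hne
  have hle : F ustar + Fbar zstar ≤ F u0 + Fbar κ := hmin _ hu0
  linarith
end

section
/- Let V be a finite type, w : V × V → ℝ with w(i,j) ≥ 0 for all i, j (edge weights), and f : V × V → ℝ with f(i,j) ≥ 0 for all i, j (a flow). Let o, d ∈ V with o ≠ d and λ > 0, and suppose f satisfies flow conservation: for every i ∈ V, Σ_j f(i,j) − Σ_j f(j,i) equals λ if i = o, equals −λ if i = d, and equals 0 otherwise. Then there exists a finite sequence of vertices v₀ = o, v₁, …, v_k = d such that f(v_{t}, v_{t+1}) > 0 for every 0 ≤ t < k, and Σ_{i,j} f(i,j)·w(i,j) ≥ λ · Σ_{t=0}^{k−1} w(v_t, v_{t+1}). -/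
/-- The weights of the finite walks from `o` to `i` along edges of positive flow. -/
def positiveWalkWeights {V : Type*} (w f : V × V → ℝ) (o i : V) : Set ℝ :=
  {c | ∃ (k : ℕ) (v : ℕ → V), v 0 = o ∧ v k = i ∧ (∀ t < k, 0 < f (v t, v (t + 1))) ∧
    ∑ t ∈ Finset.range k, w (v t, v (t + 1)) = c}

theorem zero_mem_positiveWalkWeights {V : Type*} (w f : V × V → ℝ) (o : V) :
    0 ∈ positiveWalkWeights w f o o :=
  ⟨0, fun _ => o, rfl, rfl, by simp, by simp⟩

theorem add_mem_positiveWalkWeights {V : Type*} {w f : V × V → ℝ} {o i j : V} {c : ℝ}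
    (hc : c ∈ positiveWalkWeights w f o i) (hij : 0 < f (i, j)) :
    c + w (i, j) ∈ positiveWalkWeights w f o j := by
  obtain ⟨k, v, h0, hk, hpos, hsum⟩ := hc
  have hv : ∀ t ≤ k, (if t ≤ k then v t else j) = v t := fun t ht => if_pos ht
  refine ⟨k + 1, fun t => if t ≤ k then v t else j, by simpa using h0, by simp, ?_, ?_⟩
  · intro t ht
    rcases Nat.lt_succ_iff_lt_or_eq.mp ht with h | rfl
    · simpa [h.le, Nat.succ_le_of_lt h] using hpos t h
    · simpa [hk] using hij
  · rw [Finset.sum_range_succ, ← hsum]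
    congr 1
    · refine Finset.sum_congr rfl fun t ht => ?_
      have h := Finset.mem_range.mp ht
      simp [h.le, Nat.succ_le_of_lt h]
    · simp [hk]

theorem nonneg_of_mem_positiveWalkWeights {V : Type*} {w f : V × V → ℝ} {o i : V} {c : ℝ}
    (hw : ∀ p, 0 ≤ w p) (hc : c ∈ positiveWalkWeights w f o i) : 0 ≤ c := by
  obtain ⟨k, v, -, -, -, rfl⟩ := hc
  exact Finset.sum_nonneg fun _ _ => hw _

/-- Walk weights lie in the additive monoid generated by finitely many nonnegative reals, which is
well-ordered; hence a lightest walk exists. -/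
theorem sInf_mem_positiveWalkWeights {V : Type*} [Finite V] {w f : V × V → ℝ} {o i : V}
    (hw : ∀ p, 0 ≤ w p) (hne : (positiveWalkWeights w f o i).Nonempty) :
    sInf (positiveWalkWeights w f o i) ∈ positiveWalkWeights w f o i := by
  have hsub : positiveWalkWeights w f o i ⊆ AddSubmonoid.closure (Set.range w) := by
    rintro _ ⟨k, v, -, -, -, rfl⟩
    exact sum_mem fun t _ => AddSubmonoid.subset_closure ⟨_, rfl⟩
  have hwf : (positiveWalkWeights w f o i).IsWF :=
    ((Set.IsPWO.addSubmonoid_closure (by rintro _ ⟨p, rfl⟩; exact hw p)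
      (Set.finite_range w).isPWO).mono hsub).isWF
  have hleast : IsLeast (positiveWalkWeights w f o i) (hwf.min hne) :=
    ⟨hwf.min_mem hne, fun _ hc => hwf.min_le hne hc⟩
  rw [hleast.csInf_eq]
  exact hleast.1

/-- Summation by parts: a flow pairs with a potential difference through its net outflows. -/
theorem sum_flow_mul_potential_sub {V : Type*} [Fintype V] (f : V × V → ℝ) (π : V → ℝ) :
    ∑ p : V × V, f p * (π p.2 - π p.1) =
      -∑ i, π i * ((∑ j, f (i, j)) - ∑ j, f (j, i)) := by
  simp only [mul_sub, Finset.sum_sub_distrib, Finset.mul_sum]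
  rw [Fintype.sum_prod_type_right, Fintype.sum_prod_type]
  simp only [mul_comm, neg_sub]

/-- flow-decomposition bound behind all-or-nothing assignment:
a nonnegative flow `f` routing `λ > 0` units from `o` to `d ≠ o` contains a
walk `o = v₀, v₁, …, v_k = d` along edges of positive flow, whose weight
(times `λ`) lower-bounds the total cost of the flow. -/
theorem flow_decomposition_walk_bound
    (V : Type*) [Fintype V] [DecidableEq V]
    (w f : V × V → ℝ) (hw : ∀ p, 0 ≤ w p) (hf : ∀ p, 0 ≤ f p)
    (o d : V) (hod : o ≠ d) (lam : ℝ) (hlam : 0 < lam)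
    (hcons : ∀ i : V,
      (∑ j, f (i, j)) - (∑ j, f (j, i)) =
        if i = o then lam else if i = d then -lam else 0) :
    ∃ (k : ℕ) (v : ℕ → V), v 0 = o ∧ v k = d ∧
      (∀ t < k, 0 < f (v t, v (t + 1))) ∧
      (∑ p : V × V, f p * w p) ≥
        lam * ∑ t ∈ Finset.range k, w (v t, v (t + 1)) := by
  classical
  set W := positiveWalkWeights w f o
  set cost := ∑ p : V × V, f p * w p
  have hD (i : V) : 0 ≤ sInf (W i) :=
    Real.sInf_nonneg fun _ hc => nonneg_of_mem_positiveWalkWeights hw hc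
  have hle {i : V} {c : ℝ} (hc : c ∈ W i) : sInf (W i) ≤ c :=
    csInf_le ⟨0, fun _ hc => nonneg_of_mem_positiveWalkWeights hw hc⟩ hc
  have hcost0 : 0 ≤ cost := Finset.sum_nonneg fun p _ => mul_nonneg (hf p) (hw p)
  -- Unreachable vertices get a potential exceeding every distance and `cost / lam`.
  set C := ∑ i, sInf (W i) + cost / lam + 1 with hC
  have hdiv : 0 ≤ cost / lam := div_nonneg hcost0 hlam.le
  have hDC (i : V) : sInf (W i) ≤ C := by
    have := Finset.single_le_sum (fun i _ => hD i) (Finset.mem_univ i)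
    linarith
  let π : V → ℝ := fun i => if (W i).Nonempty then sInf (W i) else C
  have hπC (i : V) : π i ≤ C := by
    by_cases hi : (W i).Nonempty
    · simpa [π, hi] using hDC i
    · simp [π, hi]
  have hedge (p : V × V) : f p * (π p.2 - π p.1) ≤ f p * w p := by
    obtain ⟨i, j⟩ := p
    rcases (hf (i, j)).eq_or_lt with h | h
    · simp [← h]
    refine mul_le_mul_of_nonneg_left ?_ h.le
    by_cases hi : (W i).Nonempty
    · have hmem := add_mem_positiveWalkWeights (sInf_mem_positiveWalkWeights hw hi) h
      have hj : (W j).Nonempty := ⟨_, hmem⟩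
      have := hle hmem
      simp only [π, if_pos hi, if_pos hj]
      linarith
    · have h1 := hπC j
      have h2 := hw (i, j)
      have h3 : π i = C := if_neg hi
      linarith
  have hdual : lam * (π d - π o) ≤ cost := by
    have hsum := Finset.sum_le_sum fun p (_ : p ∈ Finset.univ) => hedge p
    have hnet : ∑ i, π i * (if i = o then lam else if i = d then -lam else 0) =
        lam * (π o - π d) := by
      have (i : V) : π i * (if i = o then lam else if i = d then -lam else 0) =
          (if i = o then π i * lam else 0) - (if i = d then π i * lam else 0) := by
        by_cases ho : i = o
        · simp [ho, hod]
        · by_cases hd : i = d <;> simp [ho, hd, hod.symm]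
      simp only [this, Finset.sum_sub_distrib, Finset.sum_ite_eq', Finset.mem_univ, if_true]
      ring
    rw [sum_flow_mul_potential_sub] at hsum
    simp only [hcons, hnet] at hsum
    linarith
  have hπo : π o ≤ 0 := by
    have h0 : (0 : ℝ) ∈ W o := zero_mem_positiveWalkWeights w f o
    have ho : (W o).Nonempty := ⟨0, h0⟩
    simpa only [π, if_pos ho] using hle h0
  have hbound : lam * π d ≤ cost :=
    (mul_le_mul_of_nonneg_left (by linarith) hlam.le).trans hdual
  have hd : (W d).Nonempty := by
    by_contra hd
    have h1 : π d = C := if_neg hd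
    have h2 : π d ≤ cost / lam := (le_div_iff₀' hlam).mpr hbound
    have h3 : 0 ≤ ∑ i, sInf (W i) := Finset.sum_nonneg fun i _ => hD i
    linarith
  obtain ⟨k, v, h0, hk, hpos, hsum⟩ := sInf_mem_positiveWalkWeights hw hd
  refine ⟨k, v, h0, hk, hpos, ?_⟩
  rw [hsum]
  simpa only [π, if_pos hd] using hbound
end
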